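/- Let A, B, C, D ∈ ℂ be nonzero complex numbers and let α, β be nonzero real numbers with α/β irrational. Suppose f : ℝ → ℂ is continuous, satisfies f(x+1)·(A + Be(αx)) = f(x)·(C + De(βx)) for almost every x ∈ ℝ, and has minimal decay: for almost every x ∈ [0,1], f(x+n) → 0 as n → +∞ and as n → −∞ along the integers. Then f is identically zero. -/

import Mathlib

open MeasureTheory Filter

/-- `e x = e^{2πix}`. -/
noncomputable def e (x : ℝ) : ℂ := Complex.exp (2 * Real.pi * Complex.I * x)

theorem countable_setOf_add_mul_exp_eq_zero {a b : ℂ} (ha : a ≠ 0) {κ : ℝ} (hκ : κ ≠ 0) :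
    {x : ℝ | a + b * Complex.exp (κ * x * Complex.I) = 0}.Countable := by
  by_cases hb : b = 0
  · simp [hb, ha]
  have hab : -a / b ≠ 0 := div_ne_zero (neg_ne_zero.2 ha) hb
  refine (Set.countable_range fun n : ℤ =>
    ((Complex.log (-a / b) + n * (2 * Real.pi * Complex.I)) / (κ * Complex.I)).re).mono ?_
  intro x hx
  have h1 : Complex.exp (κ * x * Complex.I) = Complex.exp (Complex.log (-a / b)) := by
    rw [Complex.exp_log hab, eq_div_iff hb]
    have hx' : a + b * Complex.exp (κ * x * Complex.I) = 0 := hx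
    linear_combination hx'
  obtain ⟨n, hn⟩ := Complex.exp_eq_exp_iff_exists_int.1 h1
  refine ⟨n, ?_⟩
  have hκ' : (κ : ℂ) * Complex.I ≠ 0 := by simp [hκ]
  have : (Complex.log (-a / b) + n * (2 * Real.pi * Complex.I)) / (κ * Complex.I) = (x : ℂ) := by
    rw [div_eq_iff hκ', ← hn]; ring
  simp only [this, Complex.ofReal_re]

theorem div_one_add_mem_slitPlane_and_arg_lt {ζ : ℂ} (hζ : ‖ζ‖ < 1) {φ : ℝ} (h0 : 0 < φ)
    (h1 : φ < 2 * Real.pi) :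
    (1 + Complex.exp (φ * Complex.I) * ζ) / (1 + ζ) ∈ Complex.slitPlane ∧
      ((1 + Complex.exp (φ * Complex.I) * ζ) / (1 + ζ)).arg < φ / 2 := by
  set v := (1 + Complex.exp (φ * Complex.I) * ζ) / (1 + ζ) with hv
  have hne : 1 + ζ ≠ 0 := by
    intro h
    have : ζ = -1 := by linear_combination h
    simp [this] at hζ
  have hs : 0 < Real.sin (φ / 2) := Real.sin_pos_of_pos_of_lt_pi (by linarith) (by linarith)
  have hns : 0 < Complex.normSq (1 + ζ) := Complex.normSq_pos.2 hne
  have hnz : Complex.normSq ζ < 1 := by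
    rw [Complex.normSq_eq_norm_sq]; nlinarith [norm_nonneg ζ]
  have key : v.im * Real.cos (φ / 2) - v.re * Real.sin (φ / 2) < 0 := by
    have hc : Real.cos φ = 2 * Real.cos (φ / 2) ^ 2 - 1 := by
      rw [← Real.cos_two_mul]; ring_nf
    have hsn : Real.sin φ = 2 * Real.sin (φ / 2) * Real.cos (φ / 2) := by
      rw [← Real.sin_two_mul]; ring_nf
    have hcs := Real.sin_sq_add_cos_sq (φ / 2)
    have : v.im * Real.cos (φ / 2) - v.re * Real.sin (φ / 2) =
        -Real.sin (φ / 2) * (1 - Complex.normSq ζ) / Complex.normSq (1 + ζ) := by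
      rw [hv, Complex.div_re, Complex.div_im]
      field_simp
      simp only [Complex.normSq_apply, Complex.add_re, Complex.add_im, Complex.mul_re,
        Complex.mul_im, Complex.one_re, Complex.one_im, Complex.exp_ofReal_mul_I_re,
        Complex.exp_ofReal_mul_I_im, hc, hsn]
      generalize Real.cos (φ / 2) = c at hcs ⊢
      generalize Real.sin (φ / 2) = s at hcs ⊢
      have : c ^ 2 = 1 - s ^ 2 := by linarith
      grind
    rw [this]
    apply div_neg_of_neg_of_pos _ hns
    nlinarith
  have hslit : v ∈ Complex.slitPlane := by
    rw [Complex.mem_slitPlane_iff]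
    by_contra! h
    rw [h.2] at key
    nlinarith [h.1]
  refine ⟨hslit, ?_⟩
  by_contra! h
  have hpi := Complex.arg_le_pi v
  have hvn : 0 < ‖v‖ := norm_pos_iff.2 (Complex.slitPlane_ne_zero hslit)
  have h2 : 0 ≤ Real.sin (v.arg - φ / 2) :=
    Real.sin_nonneg_of_nonneg_of_le_pi (by linarith) (by linarith)
  rw [Real.sin_sub] at h2
  have e1 := Complex.norm_mul_cos_arg v
  have e2 := Complex.norm_mul_sin_arg v
  rw [← e1, ← e2] at key
  nlinarith [mul_nonneg hvn.le h2]

theorem div_one_add_mem_slitPlane_and_sign_mul_arg_lt {ζ : ℂ} (hζ : ‖ζ‖ < 1) {φ : ℝ} (h0 : φ ≠ 0)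
    (h1 : |φ| < 2 * Real.pi) :
    (1 + Complex.exp (φ * Complex.I) * ζ) / (1 + ζ) ∈ Complex.slitPlane ∧
      (SignType.sign φ : ℝ) * ((1 + Complex.exp (φ * Complex.I) * ζ) / (1 + ζ)).arg
        < |φ| / 2 := by
  rcases h0.lt_or_gt with h | h
  · have := div_one_add_mem_slitPlane_and_arg_lt (ζ := (starRingEnd ℂ) ζ) (φ := -φ) (by simpa)
      (by linarith) (by rwa [abs_of_neg h] at h1)
    have hconj : (1 + Complex.exp ((-φ : ℝ) * Complex.I) * (starRingEnd ℂ) ζ) /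
        (1 + (starRingEnd ℂ) ζ) =
        (starRingEnd ℂ) ((1 + Complex.exp (φ * Complex.I) * ζ) / (1 + ζ)) := by
      simp [← Complex.exp_conj]
    rw [hconj, Complex.arg_conj] at this
    obtain ⟨hs, ha⟩ := this
    have hs' : (1 + Complex.exp (φ * Complex.I) * ζ) / (1 + ζ) ∈ Complex.slitPlane := by
      rw [Complex.mem_slitPlane_iff, Complex.conj_re, Complex.conj_im, neg_ne_zero] at hs
      exact Complex.mem_slitPlane_iff.2 hs
    refine ⟨hs', ?_⟩
    rw [if_neg (Complex.mem_slitPlane_iff_arg.1 hs').1] at ha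
    simpa [sign_neg h, abs_of_neg h] using ha
  · simpa [sign_pos h, abs_of_pos h] using
      div_one_add_mem_slitPlane_and_arg_lt hζ h (by rwa [abs_of_pos h] at h1)

theorem quarter_le_re_div_add {w : ℂ} {l : ℝ} (hl : 0 < l) (hw : 0 ≤ w.re) (h : l ≤ |w.im|) :
    1 / 4 ≤ (w / (w + l)).re := by
  have h2 : l ^ 2 ≤ w.im ^ 2 := by
    rw [← sq_abs w.im]; gcongr
  have hpos : 0 < (w.re + l) * (w.re + l) + w.im * w.im := by nlinarith
  rw [Complex.div_re, ← add_div]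
  simp only [Complex.normSq_apply, Complex.add_re, Complex.add_im, Complex.ofReal_re,
    Complex.ofReal_im, add_zero]
  rw [div_le_div_iff₀ (by norm_num) hpos]
  nlinarith [sq_nonneg (w.re - l), mul_nonneg hl.le hw]

theorem re_div_add_nonneg {w : ℂ} {l : ℝ} (hl : 0 < l) (hw : 0 ≤ w.re) :
    0 ≤ (w / (w + l)).re := by
  rw [Complex.div_re, ← add_div]
  apply div_nonneg _ (Complex.normSq_nonneg _)
  simp only [Complex.add_re, Complex.add_im, Complex.ofReal_re, Complex.ofReal_im, add_zero]
  nlinarith [mul_nonneg hl.le hw, sq_nonneg w.im]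

/-- Weak-type bound for the boundary values of a holomorphic function with nonnegative real
part. -/
theorem volume_le_abs_im_le {H : ℂ → ℂ} (hd : DifferentiableOn ℂ H (Metric.ball 0 1))
    (hre : ∀ z ∈ Metric.ball (0 : ℂ) 1, 0 ≤ (H z).re) {h : ℝ} (h0 : H 0 = h) {l : ℝ} (hl : 0 < l)
    {r : ℝ} (hr0 : 0 ≤ r) (hr : r < 1) :
    (volume.restrict (Set.Ioc 0 (2 * Real.pi))).real {s | l ≤ |(H (circleMap 0 r s)).im|} ≤
      8 * Real.pi * h / l := by
  have hh : 0 ≤ h := by simpa [h0] using hre 0 (by simp)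
  have hne : ∀ z ∈ Metric.ball (0 : ℂ) 1, H z + l ≠ 0 := by
    intro z hz h'
    have := congrArg Complex.re h'
    simp at this
    linarith [hre z hz]
  have hW : DifferentiableOn ℂ (fun z => H z / (H z + l)) (Metric.ball 0 1) :=
    hd.div (hd.add_const _) hne
  have hmem : ∀ s, circleMap 0 r s ∈ Metric.ball (0 : ℂ) 1 := by
    intro s
    simpa [abs_of_nonneg hr0] using hr
  have hcont : Continuous fun s => H (circleMap 0 r s) / (H (circleMap 0 r s) + l) :=
    hW.continuousOn.comp_continuous (continuous_circleMap 0 r) hmem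
  have hav := DiffContOnCl.circleAverage (R := r)
    (hW.diffContOnCl_ball (c := 0) (R := |r|)
      (Metric.closedBall_subset_ball (by rwa [abs_of_nonneg hr0])))
  have hint : ∫ s in (0)..(2 * Real.pi), (H (circleMap 0 r s) / (H (circleMap 0 r s) + l)).re =
      2 * Real.pi * (h / (h + l)) := by
    have h1 := Complex.reCLM.intervalIntegral_comp_comm
      (hcont.intervalIntegrable (μ := volume) 0 (2 * Real.pi))
    simp only [Complex.reCLM_apply] at h1
    rw [h1]
    rw [Real.circleAverage_def, h0, inv_smul_eq_iff₀ (by positivity)] at hav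
    rw [hav, Complex.smul_re, smul_eq_mul]
    congr 1
    rw [← Complex.ofReal_add, ← Complex.ofReal_div, Complex.ofReal_re]
  rw [intervalIntegral.integral_of_le (by positivity)] at hint
  have hmarkov := mul_meas_ge_le_integral_of_nonneg
    (μ := volume.restrict (Set.Ioc 0 (2 * Real.pi)))
    (f := fun s => (H (circleMap 0 r s) / (H (circleMap 0 r s) + l)).re)
    (Eventually.of_forall fun s => re_div_add_nonneg hl (hre _ (hmem s)))
    ((Complex.continuous_re.comp hcont).integrableOn_Ioc) (1 / 4)
  rw [hint] at hmarkov
  have hmono : (volume.restrict (Set.Ioc 0 (2 * Real.pi))).real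
        {s | l ≤ |(H (circleMap 0 r s)).im|} ≤
      (volume.restrict (Set.Ioc 0 (2 * Real.pi))).real
        {s | 1 / 4 ≤ (H (circleMap 0 r s) / (H (circleMap 0 r s) + l)).re} :=
    measureReal_mono fun s hs => quarter_le_re_div_add hl (hre _ (hmem s)) hs
  have hfrac : h / (h + l) ≤ h / l := by gcongr; linarith
  have : 8 * Real.pi * h / l = 4 * (2 * Real.pi * (h / l)) := by ring
  rw [this]
  have : 2 * Real.pi * (h / (h + l)) ≤ 2 * Real.pi * (h / l) := by gcongr
  linarith

theorem volume_le_abs_sum_log_interior_le (N : ℕ) {c : ℕ → ℂ} (hc : ∀ k, ‖c k‖ ≤ 1) {φ : ℝ}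
    (h0 : φ ≠ 0) (h1 : |φ| < 2 * Real.pi) {l : ℝ} (hl : 0 < l) {r : ℝ} (hr0 : 0 ≤ r) (hr : r < 1) :
    (volume.restrict (Set.Ioc 0 (2 * Real.pi))).real {s | l ≤ |∑ k ∈ Finset.range N,
      Real.log ‖(1 + Complex.exp (φ * Complex.I) * (c k * circleMap 0 r s)) /
        (1 + c k * circleMap 0 r s)‖|} ≤ 4 * Real.pi * (N * |φ|) / l := by
  set σ : ℝ := (SignType.sign φ : ℝ) with hσ
  have hσ1 : |σ| = 1 := by
    rcases h0.lt_or_gt with h | h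
    · simp [hσ, sign_neg h]
    · simp [hσ, sign_pos h]
  set v : ℕ → ℂ → ℂ := fun k z =>
    (1 + Complex.exp (φ * Complex.I) * (c k * z)) / (1 + c k * z) with hv
  have hcz : ∀ k, ∀ z ∈ Metric.ball (0 : ℂ) 1, ‖c k * z‖ < 1 := by
    intro k z hz
    rw [norm_mul]
    have : ‖z‖ < 1 := by simpa using hz
    nlinarith [hc k, norm_nonneg z, norm_nonneg (c k)]
  have hvk := fun k z hz => div_one_add_mem_slitPlane_and_sign_mul_arg_lt (hcz k z hz) h0 h1
  set H : ℂ → ℂ := fun z => ∑ k ∈ Finset.range N,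
    (((|φ| / 2 : ℝ) : ℂ) + (σ : ℂ) * (Complex.I * Complex.log (v k z))) with hH
  have hd : DifferentiableOn ℂ H (Metric.ball 0 1) := by
    refine DifferentiableOn.fun_sum fun k _ => ?_
    refine (((DifferentiableOn.clog ?_ fun z hz =>
      (hvk k z hz).1).const_mul _).const_mul _).const_add _
    refine DifferentiableOn.div (by fun_prop) (by fun_prop) fun z hz h => ?_
    have h2 := hcz k z hz
    rw [show c k * z = -1 by linear_combination h] at h2
    simp at h2
  have hre : ∀ z ∈ Metric.ball (0 : ℂ) 1, 0 ≤ (H z).re := by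
    intro z hz
    rw [hH, Complex.re_sum]
    refine Finset.sum_nonneg fun k _ => ?_
    have := (hvk k z hz).2
    simp only [Complex.add_re, Complex.ofReal_re, Complex.re_ofReal_mul, Complex.I_mul_re,
      Complex.log_im]
    linarith
  have hH0 : H 0 = ((N * (|φ| / 2) : ℝ) : ℂ) := by
    simp [hH, hv]
  have him : ∀ z, |(H z).im| = |∑ k ∈ Finset.range N, Real.log ‖v k z‖| := by
    intro z
    have : (H z).im = σ * ∑ k ∈ Finset.range N, Real.log ‖v k z‖ := by
      rw [hH, Complex.im_sum, Finset.mul_sum]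
      refine Finset.sum_congr rfl fun k _ => ?_
      simp only [Complex.add_im, Complex.ofReal_im, Complex.im_ofReal_mul, Complex.I_mul_im,
        Complex.log_re, zero_add]
    rw [this, abs_mul, hσ1, one_mul]
  have := volume_le_abs_im_le hd hre hH0 hl hr0 hr
  simp only [him] at this
  refine this.trans (le_of_eq ?_)
  ring

theorem volume_le_abs_sum_log_le (N : ℕ) {c : ℕ → ℂ} (hc : ∀ k, ‖c k‖ ≤ 1) {φ : ℝ}
    (h0 : φ ≠ 0) (h1 : |φ| < 2 * Real.pi) {l : ℝ} (hl : 0 < l) :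
    (volume.restrict (Set.Ioc 0 (2 * Real.pi))).real {s : ℝ | l ≤ |∑ k ∈ Finset.range N,
      Real.log ‖(1 + Complex.exp (φ * Complex.I) * (c k * Complex.exp (s * Complex.I))) /
        (1 + c k * Complex.exp (s * Complex.I))‖|} ≤ 8 * Real.pi * (N * |φ|) / l := by
  set μ := volume.restrict (Set.Ioc 0 (2 * Real.pi)) with hμ
  set g : ℝ → ℝ → ℝ := fun r s => ∑ k ∈ Finset.range N,
      Real.log ‖(1 + Complex.exp (φ * Complex.I) * (c k * circleMap 0 r s)) /
        (1 + c k * circleMap 0 r s)‖ with hg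
  have hg1 : ∀ s : ℝ, g 1 s = ∑ k ∈ Finset.range N,
      Real.log ‖(1 + Complex.exp (φ * Complex.I) * (c k * Complex.exp (s * Complex.I))) /
        (1 + c k * Complex.exp (s * Complex.I))‖ := by
    intro s
    simp [hg, circleMap]
  simp only [← hg1]
  set r : ℕ → ℝ := fun n => 1 - 1 / ((n : ℝ) + 2) with hr
  have hr0 : ∀ n, 0 ≤ r n := by
    intro n
    have : 1 / ((n : ℝ) + 2) ≤ 1 := by
      rw [div_le_one (by positivity)]; linarith [(Nat.cast_nonneg n : (0 : ℝ) ≤ n)]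
    simp only [hr]; linarith
  have hr1 : ∀ n, r n < 1 := by
    intro n
    have : 0 < 1 / ((n : ℝ) + 2) := by positivity
    simp only [hr]; linarith
  have hrlim : Tendsto r atTop (nhds 1) := by
    have : Tendsto (fun n : ℕ => 1 / ((n : ℝ) + 2)) atTop (nhds 0) :=
      tendsto_const_nhds.div_atTop (tendsto_atTop_add_const_right _ _ tendsto_natCast_atTop_atTop)
    simpa [hr] using this.const_sub 1
  have hmeas : ∀ r, Measurable (g r) := by
    intro r
    have : ∀ c : ℂ, Measurable fun s => c * circleMap 0 r s := fun c =>
      ((continuous_circleMap 0 r).measurable).const_mul c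
    refine Finset.measurable_sum _ fun k _ => Real.measurable_log.comp (Measurable.norm ?_)
    exact (((this (c k)).const_mul _).const_add 1).div ((this (c k)).const_add 1)
  have hnull : ∀ a : ℂ, ∀ᵐ s : ℝ ∂μ, 1 + a * Complex.exp (s * Complex.I) ≠ 0 := by
    intro a
    refine ae_restrict_of_ae ?_
    have := countable_setOf_add_mul_exp_eq_zero (a := 1) (b := a) one_ne_zero one_ne_zero
    simp only [Complex.ofReal_one, one_mul] at this
    simpa using this.ae_notMem volume
  have hae : ∀ᵐ s ∂μ, Tendsto (fun n => g (r n) s) atTop (nhds (g 1 s)) := by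
    have h2 := ae_all_iff.2 fun k => hnull (c k)
    have h3 := ae_all_iff.2 fun k => hnull (Complex.exp (φ * Complex.I) * c k)
    filter_upwards [h2, h3] with s hs2 hs3
    refine tendsto_finsetSum _ fun k _ => ?_
    have hcm : Tendsto (fun n => circleMap 0 (r n) s) atTop (nhds (circleMap 0 1 s)) := by
      simp only [circleMap]
      exact ((Complex.continuous_ofReal.tendsto _).comp hrlim).mul_const _ |>.const_add 0
    have hne2 : 1 + c k * circleMap 0 1 s ≠ 0 := by simpa [circleMap] using hs2 k
    have hne3 : 1 + Complex.exp (φ * Complex.I) * (c k * circleMap 0 1 s) ≠ 0 := by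
      simpa [circleMap, mul_assoc] using hs3 k
    refine Tendsto.log (Tendsto.norm ?_) (norm_ne_zero_iff.2 (div_ne_zero hne3 hne2))
    exact (((hcm.const_mul _).const_mul _).const_add _).div ((hcm.const_mul _).const_add _) hne2
  have hTM := tendstoInMeasure_of_tendsto_ae (μ := μ)
    (fun n => (hmeas (r n)).aestronglyMeasurable) hae
  have hlim := tendstoInMeasure_iff_measureReal_norm.1 hTM (l / 2) (by positivity)
  have hbound : ∀ n, μ.real {s | l ≤ |g 1 s|} ≤
      8 * Real.pi * (N * |φ|) / l + μ.real {s | l / 2 ≤ ‖g (r n) s - g 1 s‖} := by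
    intro n
    have hA := volume_le_abs_sum_log_interior_le N hc h0 h1 (half_pos hl) (hr0 n) (hr1 n)
    have hsub : {s | l ≤ |g 1 s|} ⊆
        {s | l / 2 ≤ |g (r n) s|} ∪ {s | l / 2 ≤ ‖g (r n) s - g 1 s‖} := by
      intro s hs
      by_contra hcon
      simp only [Set.mem_union, Set.mem_ofPred_eq, not_or, not_le, Real.norm_eq_abs] at hcon hs
      have := abs_sub_abs_le_abs_sub (g 1 s) (g (r n) s)
      rw [abs_sub_comm] at this
      linarith
    calc μ.real {s | l ≤ |g 1 s|} ≤ _ := measureReal_mono hsub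
      _ ≤ _ := measureReal_union_le _ _
      _ ≤ _ := by
        gcongr
        refine hA.trans (le_of_eq ?_)
        field_simp
        ring
  have := ge_of_tendsto' (hlim.const_add (8 * Real.pi * (N * |φ|) / l)) hbound
  simpa using this

theorem e_eq_exp (x : ℝ) : e x = Complex.exp ((2 * Real.pi * x : ℝ) * Complex.I) := by
  rw [e]; congr 1; push_cast; ring

theorem e_add (x y : ℝ) : e (x + y) = e x * e y := by
  rw [e, e, e, ← Complex.exp_add]; congr 1; push_cast; ring

theorem e_intCast (n : ℤ) : e n = 1 := by
  rw [e, Complex.exp_eq_one_iff]; exact ⟨n, by push_cast; ring⟩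

theorem norm_e (x : ℝ) : ‖e x‖ = 1 := by
  rw [e_eq_exp, Complex.norm_exp_ofReal_mul_I]

theorem continuous_e : Continuous e := by
  unfold e; fun_prop

theorem conj_e (x : ℝ) : (starRingEnd ℂ) (e x) = (e x)⁻¹ := by
  rw [Complex.inv_def, Complex.normSq_eq_norm_sq, norm_e]; simp

theorem countable_setOf_add_mul_e_eq_zero {a b : ℂ} (ha : a ≠ 0) {κ : ℝ} (hκ : κ ≠ 0) :
    {x : ℝ | a + b * e (κ * x) = 0}.Countable := by
  have := countable_setOf_add_mul_exp_eq_zero (b := b) ha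
    (mul_ne_zero Real.two_pi_pos.ne' hκ)
  convert this using 6
  rw [e_eq_exp]; push_cast; ring_nf

theorem exists_nat_gt_abs_mul_sub_round_le {κ : ℝ} (hκ : Irrational κ) (K : ℕ) :
    ∃ k : ℕ, K < k ∧ |k * κ - round (k * κ)| ≤ 1 / k := by
  have hpos : ∀ k : ℕ, 0 < k → 0 < |k * κ - round (k * κ)| := by
    intro k hk
    exact abs_pos.2 (sub_ne_zero.2 ((hκ.natCast_mul hk.ne').ne_int _))
  obtain ⟨d, hd, hdk⟩ : ∃ d : ℝ, 0 < d ∧ ∀ k : ℕ, 0 < k → k ≤ K →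
      d < |k * κ - round (k * κ)| := by
    induction K with
    | zero => exact ⟨1, one_pos, fun k h1 h2 => by omega⟩
    | succ K ih =>
      obtain ⟨d, hd, h⟩ := ih
      have hp := hpos (K + 1) K.succ_pos
      refine ⟨min d (|(K + 1 : ℕ) * κ - round ((K + 1 : ℕ) * κ)| / 2), lt_min hd (half_pos hp), ?_⟩
      intro k h1 h2
      rcases Nat.lt_or_ge K k with h3 | h3
      · obtain rfl : k = K + 1 := by omega
        exact (min_le_right _ _).trans_lt (half_lt_self hp)
      · exact (min_le_left _ _).trans_lt (h k h1 h3)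
  obtain ⟨n, hn⟩ := exists_nat_one_div_lt hd
  obtain ⟨k, hk0, hkn, hk⟩ := Real.exists_nat_abs_mul_sub_round_le κ n.succ_pos
  have hk0' : (0 : ℝ) < k := by exact_mod_cast hk0
  have hkn' : (k : ℝ) ≤ n + 1 := by exact_mod_cast hkn
  refine ⟨k, ?_, hk.trans ?_⟩
  · by_contra! hle
    have h1 := hdk k hk0 hle
    have h2 : 1 / (((n.succ : ℕ) : ℝ) + 1) ≤ 1 / ((n : ℝ) + 1) := by
      push_cast; gcongr; linarith
    linarith
  · push_cast
    gcongr
    linarith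

/-- There are arbitrarily large multiples `t` of `τ` which are close to an integer `n` and for
which the distance `|θ|` from `β t` to an integer is `O(1 / n)`. -/
theorem exists_almost_period {τ β : ℝ} (hτ : 0 < τ) (hirr : Irrational (β * τ)) (M : ℕ)
    (hM : 0 < M) : ∃ K : ℝ, 0 < K ∧ ∀ n₀ : ℕ, ∃ (n j : ℕ) (i : ℤ) (θ : ℝ), n₀ ≤ n ∧
      |j * τ - n| ≤ 1 / (M + 1) ∧ β * (j * τ) = θ + i ∧ θ ≠ 0 ∧ |θ| < 1 ∧ n * |θ| ≤ K := by
  have hM' : (1 : ℝ) ≤ M := by exact_mod_cast hM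
  refine ⟨M ^ 2 * τ + M, by positivity, fun n₀ => ?_⟩
  obtain ⟨k₀, hk₀⟩ := exists_nat_gt ((n₀ + 1) / τ)
  obtain ⟨k, hk, hkκ⟩ := exists_nat_gt_abs_mul_sub_round_le hirr (max k₀ M)
  have hkM : (M : ℝ) < k := by exact_mod_cast (le_max_right k₀ M).trans_lt hk
  have hkk : (k₀ : ℝ) < k := by exact_mod_cast (le_max_left k₀ M).trans_lt hk
  have hk1 : (0 : ℝ) < k := by linarith
  obtain ⟨a, ha0, haM, ha⟩ := Real.exists_nat_abs_mul_sub_round_le (k * τ) hM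
  have ha0' : (1 : ℝ) ≤ a := by exact_mod_cast ha0
  have haM' : (a : ℝ) ≤ M := by exact_mod_cast haM
  have hfr : 1 / ((M : ℝ) + 1) ≤ 1 := by rw [div_le_one (by positivity)]; linarith
  have hkτ : (n₀ : ℝ) + 1 < k * τ := by
    rw [div_lt_iff₀ hτ] at hk₀
    nlinarith
  have hakτ : k * τ ≤ a * (k * τ) := by nlinarith [mul_pos hk1 hτ]
  obtain ⟨h1, h2⟩ := abs_le.1 ha
  have hround : (n₀ : ℝ) ≤ round (a * (k * τ)) := by linarith
  have hround' : (n₀ : ℤ) ≤ round (a * (k * τ)) := by exact_mod_cast hround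
  obtain ⟨n, hn⟩ := Int.eq_ofNat_of_zero_le (show 0 ≤ round (a * (k * τ)) by omega)
  have hnr : ((n : ℕ) : ℝ) = (round (a * (k * τ)) : ℝ) := by rw [hn]; simp
  set κ := β * τ with hκ
  have hθ : |a * (k * κ - round (k * κ))| ≤ M / k := by
    rw [abs_mul, Nat.abs_cast]
    calc (a : ℝ) * |k * κ - round (k * κ)| ≤ M * (1 / k) := by gcongr
      _ = M / k := by ring
  refine ⟨n, a * k, a * round (k * κ), a * (k * κ - round (k * κ)), by omega, ?_, ?_, ?_, ?_, ?_⟩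
  · rw [hnr]; push_cast; rwa [mul_assoc]
  · rw [hκ]; push_cast; ring
  · refine mul_ne_zero (by positivity) (sub_ne_zero.2 ?_)
    exact (hirr.natCast_mul (by rintro rfl; simp at hk1)).ne_int _
  · refine hθ.trans_lt ?_
    rwa [div_lt_one hk1]
  · have hn1 : (n : ℝ) ≤ M * (k * τ) + 1 := by
      have : (a : ℝ) * (k * τ) ≤ M * (k * τ) := by gcongr
      linarith
    calc (n : ℝ) * |a * (k * κ - round (k * κ))| ≤ (M * (k * τ) + 1) * (M / k) := by gcongr
      _ = M ^ 2 * τ + M / k := by field_simp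
      _ ≤ M ^ 2 * τ + M := by
        gcongr
        exact div_le_self (by positivity) (by linarith)

theorem mul_prod_eq_of_recurrence {F p q : ℝ → ℝ} (h : ∀ x, F (x + 1) * p x = F x * q x) (n : ℕ)
    (y : ℝ) : F (y + n) * ∏ k ∈ Finset.range n, p (y + k) =
      F y * ∏ k ∈ Finset.range n, q (y + k) := by
  induction n with
  | zero => simp
  | succ n ih =>
    rw [Finset.prod_range_succ, Finset.prod_range_succ]
    have := h (y + n)
    push_cast
    rw [← add_assoc]
    linear_combination (∏ k ∈ Finset.range n, p (y + k)) * this + q (y + n) * ih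

theorem volume_le_abs_sum_log_translate_le {C D : ℂ} (hC : C ≠ 0) (hCD : ‖D‖ ≤ ‖C‖) {β : ℝ}
    (hβ : β ≠ 0) (N : ℕ) (b : ℝ) {θ : ℝ} (h0 : θ ≠ 0) (h1 : |θ| < 1) {l : ℝ} (hl : 0 < l) :
    volume {u : ℝ | |u| < 1 / (2 * |β|) ∧ l ≤ |∑ k ∈ Finset.range N,
      Real.log (‖C + D * e (β * (b + u + k) + θ)‖ / ‖C + D * e (β * (b + u + k))‖)|} ≤
      ENNReal.ofReal (8 * Real.pi * (N * |θ|) / (|β| * l)) := by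
  set c : ℕ → ℂ := fun k => -(D / C * e (β * (b + k))) with hc
  have hc1 : ∀ k, ‖c k‖ ≤ 1 := by
    intro k
    rw [hc, norm_neg, norm_mul, norm_e, mul_one, norm_div]
    exact div_le_one_of_le₀ hCD (norm_nonneg _)
  have hpi := Real.pi_pos
  set φ : ℝ := 2 * Real.pi * θ with hφ
  have hφabs : |φ| = 2 * Real.pi * |θ| := by
    rw [hφ, abs_mul, abs_of_pos Real.two_pi_pos]
  have hweak := volume_le_abs_sum_log_le N hc1 (φ := φ) (mul_ne_zero Real.two_pi_pos.ne' h0)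
    (by rw [hφabs]; nlinarith) hl
  set S := {s : ℝ | l ≤ |∑ k ∈ Finset.range N,
      Real.log ‖(1 + Complex.exp (φ * Complex.I) * (c k * Complex.exp (s * Complex.I))) /
        (1 + c k * Complex.exp (s * Complex.I))‖|} with hS
  have hsub : {u : ℝ | |u| < 1 / (2 * |β|) ∧ l ≤ |∑ k ∈ Finset.range N,
      Real.log (‖C + D * e (β * (b + u + k) + θ)‖ / ‖C + D * e (β * (b + u + k))‖)|} ⊆
      (fun u => 2 * Real.pi * β * u) ⁻¹'
        ((fun s => s + Real.pi) ⁻¹' (S ∩ Set.Ioc 0 (2 * Real.pi))) := by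
    rintro u ⟨hu, hul⟩
    have hβ' : 0 < |β| := abs_pos.2 hβ
    have hbu : |2 * Real.pi * β * u| < Real.pi := by
      rw [lt_div_iff₀ (by positivity)] at hu
      rw [abs_mul, abs_mul, abs_of_pos Real.two_pi_pos]
      nlinarith
    obtain ⟨hb1, hb2⟩ := abs_lt.1 hbu
    refine ⟨?_, by constructor <;> linarith⟩
    rw [hS, Set.mem_ofPred_eq]
    convert hul using 5 with k _
    have hz : Complex.exp (((2 * Real.pi * β * u + Real.pi : ℝ) : ℂ) * Complex.I) =
        -e (β * u) := by
      rw [e_eq_exp, Complex.ofReal_add, add_mul, Complex.exp_add, Complex.exp_pi_mul_I]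
      simp only [mul_neg, mul_one]
      congr 4; ring
    have hw : Complex.exp (φ * Complex.I) = e θ := by rw [e_eq_exp]
    rw [hz, hw, ← norm_div]
    have e1 : C + D * e (β * (b + u + k)) = C * (1 + c k * -e (β * u)) := by
      rw [show β * (b + u + k) = β * (b + k) + β * u by ring, e_add, hc]
      field_simp
    have e2 : C + D * e (β * (b + u + k) + θ) = C * (1 + e θ * (c k * -e (β * u))) := by
      rw [show β * (b + u + k) = β * (b + k) + β * u by ring, e_add, e_add, hc]
      field_simp
    rw [e1, e2, mul_div_mul_left _ _ hC]
  refine (measure_mono hsub).trans ?_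
  rw [Real.volume_preimage_mul_left (by positivity), measure_preimage_add_right,
    ← Measure.restrict_apply' measurableSet_Ioc, ← ENNReal.ofReal_toReal (measure_ne_top _ S),
    ← ENNReal.ofReal_mul (abs_nonneg _)]
  apply ENNReal.ofReal_le_ofReal
  have hβ' : 0 < |β| := abs_pos.2 hβ
  calc |(2 * Real.pi * β)⁻¹| * _ ≤ |(2 * Real.pi * β)⁻¹| * (8 * Real.pi * (N * |φ|) / l) := by
        gcongr
        exact hweak
    _ = _ := by
        rw [hφabs, abs_inv, abs_mul, abs_of_pos Real.two_pi_pos]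
        field_simp

theorem tendsto_volume_translate_ge {F : ℝ → ℝ} (hF : Continuous F) {a : ℕ → ℝ}
    (h : ∀ᵐ x, Tendsto (fun n => F (x + a n)) atTop (nhds 0)) (x₀ η : ℝ) {ε : ℝ} (hε : 0 < ε) :
    Tendsto (fun n => volume (Metric.ball x₀ η ∩ {x | ε ≤ F (x + a n)})) atTop (nhds 0) := by
  have : IsFiniteMeasure (volume.restrict (Metric.ball x₀ η)) :=
    isFiniteMeasure_restrict.2 measure_ball_lt_top.ne
  have hTM := tendstoInMeasure_of_tendsto_ae (μ := volume.restrict (Metric.ball x₀ η))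
    (f := fun n x => F (x + a n)) (g := fun _ => 0)
    (fun n => (hF.comp (continuous_add_const (a n))).aestronglyMeasurable)
    (ae_restrict_of_ae h)
  refine tendsto_of_tendsto_of_tendsto_of_le_of_le tendsto_const_nhds
    (tendstoInMeasure_iff_norm.1 hTM ε hε) (fun _ => zero_le) fun n => ?_
  rw [Measure.restrict_apply' measurableSet_ball, Set.inter_comm]
  refine measure_mono (Set.inter_subset_inter_left _ fun x hx => ?_)
  simpa using le_trans hx (le_abs_self _)

/-- The core of the argument, for the absolute value `F` of a solution: compare the products of
the coefficients along an orbit and along its translate by an almost period `t`. -/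
theorem eq_zero_of_recurrence_of_norm_le {F p : ℝ → ℝ} {C D : ℂ} {τ β : ℝ} (hC : C ≠ 0)
    (hCD : ‖D‖ ≤ ‖C‖) (hτ : 0 < τ) (hβ : β ≠ 0) (hirr : Irrational (β * τ)) (hF : Continuous F)
    (hF0 : ∀ x, 0 ≤ F x) (hp : Function.Periodic p τ) (hp0 : {x | p x = 0}.Countable)
    (heq : ∀ x, F (x + 1) * p x = F x * ‖C + D * e (β * x)‖)
    (hpos : ∀ᵐ x, Tendsto (fun n : ℕ => F (x + n)) atTop (nhds 0))
    (hneg : ∀ᵐ x, Tendsto (fun n : ℕ => F (x + -n)) atTop (nhds 0)) (x₀ : ℝ) : F x₀ = 0 := by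
  by_contra hne
  have hx₀ : 0 < F x₀ := (hF0 x₀).lt_of_ne' hne
  set q : ℝ → ℝ := fun x => ‖C + D * e (β * x)‖ with hq
  have hq0 : {x | q x = 0}.Countable := by
    simpa [hq] using countable_setOf_add_mul_e_eq_zero (b := D) hC hβ
  set δ := F x₀ / 2 with hδ
  have hδ0 : 0 < δ := half_pos hx₀
  obtain ⟨η₀, hη₀, hball⟩ := Metric.eventually_nhds_iff.1
    (hF.continuousAt.eventually (lt_mem_nhds (half_lt_self hx₀)))
  have hβ' : 0 < |β| := abs_pos.2 hβ
  set η := min (η₀ / 2) (1 / (2 * |β|)) with hη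
  have hη0 : 0 < η := lt_min (by positivity) (by positivity)
  obtain ⟨M, hM⟩ := exists_nat_one_div_lt (half_pos hη₀)
  have hM2 : 1 / (((M + 1 : ℕ) : ℝ) + 1) < η₀ / 2 := by
    refine lt_of_le_of_lt ?_ hM
    push_cast; gcongr; linarith
  have hM1 : 1 / (((M + 1 : ℕ) : ℝ) + 1) ≤ 1 := by
    rw [div_le_one (by positivity)]; push_cast; linarith [(Nat.cast_nonneg M : (0 : ℝ) ≤ M)]
  obtain ⟨K, hK, happrox⟩ := exists_almost_period hτ hirr (M + 1) M.succ_pos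
  have hpi := Real.pi_pos
  set l := 16 * Real.pi * K / (|β| * η) with hl
  have hl0 : 0 < l := by positivity
  set ε := δ * Real.exp (-l) with hε
  have hε0 : 0 < ε := by positivity
  have hquarter : (0 : ENNReal) < ENNReal.ofReal (η / 4) := by
    simpa using hη0
  have hev := ((tendsto_volume_translate_ge hF hpos x₀ (η + 1) hε0).eventually_lt_const
    hquarter).and ((tendsto_volume_translate_ge hF hneg x₀ (η + 1) hε0).eventually_lt_const hquarter)
  obtain ⟨n₀, hn₀⟩ := eventually_atTop.1 hev
  obtain ⟨n, j, i, θ, hn, hr, hβt, hθ0, hθ1, hnθ⟩ := happrox n₀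
  obtain ⟨hv1, hv2⟩ := hn₀ n hn
  set t := j * τ with ht
  set r := t - n with hrdef
  have hr1 : |r| ≤ 1 := hr.trans hM1
  have hpt : ∀ x, p (x + t) = p x := hp.nat_mul j
  have hqt : ∀ x, q (x + t) = ‖C + D * e (β * x + θ)‖ := by
    intro x
    simp only [hq]
    rw [mul_add, hβt, ← add_assoc, e_add _ (i : ℝ), e_intCast, mul_one]
  set B₁ := Metric.ball x₀ (η + 1) ∩ {x | ε ≤ F (x + -n)} with hB₁
  set B₂ := (fun x => x + r) ⁻¹' (Metric.ball x₀ (η + 1) ∩ {x | ε ≤ F (x + n)}) with hB₂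
  set B₃ := (fun x => x + -x₀) ⁻¹' {u : ℝ | |u| < 1 / (2 * |β|) ∧
    l ≤ |∑ k ∈ Finset.range n, Real.log (‖C + D * e (β * (x₀ - n + u + k) + θ)‖ /
      ‖C + D * e (β * (x₀ - n + u + k))‖)|} with hB₃
  set B₄ := ⋃ k : ℕ, ((fun x : ℝ => x + (-n + k)) ⁻¹' {x | p x = 0} ∪
    (fun x : ℝ => x + (-n + k)) ⁻¹' {x | q x = 0} ∪
    (fun x : ℝ => x + (-n + k + t)) ⁻¹' {x | q x = 0}) with hB₄
  have hV₂ : volume B₂ < ENNReal.ofReal (η / 4) := by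
    rwa [hB₂, measure_preimage_add_right]
  have hV₃ : volume B₃ ≤ ENNReal.ofReal (η / 2) := by
    rw [hB₃, measure_preimage_add_right]
    refine (volume_le_abs_sum_log_translate_le hC hCD hβ n (x₀ - n) hθ0 hθ1 hl0).trans
      (ENNReal.ofReal_le_ofReal ?_)
    calc 8 * Real.pi * (n * |θ|) / (|β| * l) ≤ 8 * Real.pi * K / (|β| * l) := by gcongr
      _ = η / 2 := by rw [hl]; field_simp; norm_num
  have hV₄ : volume B₄ = 0 := by
    refine Set.Countable.measure_zero (Set.countable_iUnion fun k => ?_) _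
    exact ((hp0.preimage (add_left_injective _)).union
      (hq0.preimage (add_left_injective _))).union (hq0.preimage (add_left_injective _))
  obtain ⟨x, hxball, hxB⟩ : ∃ x ∈ Metric.ball x₀ η, x ∉ B₁ ∪ B₂ ∪ B₃ ∪ B₄ := by
    by_contra! hcon
    have h1 : volume (Metric.ball x₀ η) ≤ ENNReal.ofReal η := by
      calc volume (Metric.ball x₀ η) ≤ volume (B₁ ∪ B₂ ∪ B₃ ∪ B₄) := measure_mono hcon
        _ ≤ volume B₁ + volume B₂ + volume B₃ + volume B₄ :=
          (measure_union_le _ _).trans (by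
            gcongr
            exact (measure_union_le _ _).trans (by gcongr; exact measure_union_le _ _))
        _ ≤ ENNReal.ofReal (η / 4) + ENNReal.ofReal (η / 4) + ENNReal.ofReal (η / 2) + 0 := by
          gcongr
          exact hV₄.le
        _ = ENNReal.ofReal η := by
          rw [add_zero, ← ENNReal.ofReal_add (by positivity) (by positivity),
            ← ENNReal.ofReal_add (by positivity) (by positivity)]
          congr 1; ring
    rw [Real.volume_ball, ENNReal.ofReal_le_ofReal_iff hη0.le] at h1
    linarith
  simp only [Set.mem_union, not_or] at hxB
  obtain ⟨⟨⟨hx1, hx2⟩, hx3⟩, hx4⟩ := hxB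
  have hxη : |x - x₀| < η := by simpa [Real.dist_eq] using hxball
  have hxη₀ : |x - x₀| < η₀ / 2 := hxη.trans_le (min_le_left _ _)
  have hxrη₀ : |x + r - x₀| < η₀ := by
    have := abs_add_le (x - x₀) r
    rw [show x + r - x₀ = x - x₀ + r by ring]
    linarith
  have hFx : δ < F x := hball (by rw [Real.dist_eq]; linarith)
  have hFxr : δ < F (x + r) := hball (by rwa [Real.dist_eq])
  have hFy : F (x + -n) < ε := by
    by_contra! h
    refine hx1 ⟨?_, h⟩
    rw [Metric.mem_ball, Real.dist_eq]; linarith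
  have hFz : F (x + r + n) < ε := by
    by_contra! h
    refine hx2 ⟨?_, h⟩
    rw [Metric.mem_ball, Real.dist_eq]
    have := abs_add_le (x - x₀) r
    rw [show x + r - x₀ = x - x₀ + r by ring]
    linarith
  set y := x + -n with hy
  have hnz : ∀ k : ℕ, p (y + k) ≠ 0 ∧ q (y + k) ≠ 0 ∧ q (y + t + k) ≠ 0 := by
    intro k
    have := fun h => hx4 (Set.mem_iUnion.2 ⟨k, h⟩)
    simp only [Set.mem_union, Set.mem_preimage, Set.mem_ofPred_eq, imp_false, not_or] at this
    obtain ⟨⟨h1, h2⟩, h3⟩ := this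
    refine ⟨by rwa [hy, add_assoc], by rwa [hy, add_assoc], ?_⟩
    rwa [show y + t + k = x + (-n + k + t) by rw [hy]; ring]
  have hprod1 := mul_prod_eq_of_recurrence heq n y
  have hprod2 := mul_prod_eq_of_recurrence heq n (y + t)
  have hPt : ∏ k ∈ Finset.range n, p (y + t + k) = ∏ k ∈ Finset.range n, p (y + k) :=
    Finset.prod_congr rfl fun k _ => by rw [add_right_comm, hpt]
  rw [hPt] at hprod2
  have hP : ∏ k ∈ Finset.range n, p (y + k) ≠ 0 := Finset.prod_ne_zero_iff.2 fun k _ => (hnz k).1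
  have hq_pos : ∀ x, q x ≠ 0 → 0 < q x := fun x h => (norm_nonneg _).lt_of_ne' h
  have hQ : 0 < ∏ k ∈ Finset.range n, q (y + k) :=
    Finset.prod_pos fun k _ => hq_pos _ (hnz k).2.1
  have hQ' : 0 < ∏ k ∈ Finset.range n, q (y + t + k) :=
    Finset.prod_pos fun k _ => hq_pos _ (hnz k).2.2
  have hlog : |∑ k ∈ Finset.range n, Real.log (q (y + t + k) / q (y + k))| < l := by
    by_contra! h
    refine hx3 ⟨?_, ?_⟩
    · change |x + -x₀| < _
      rw [← sub_eq_add_neg]; exact hxη.trans_le (min_le_right _ _)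
    · simp only [add_right_comm y t, hqt] at h
      change l ≤ |∑ k ∈ Finset.range n, Real.log (‖C + D * e (β * (x₀ - n + (x + -x₀) + k) + θ)‖ /
        ‖C + D * e (β * (x₀ - n + (x + -x₀) + k))‖)|
      rwa [show x₀ - n + (x + -x₀) = y by rw [hy]; ring]
  rw [← Real.log_prod fun k _ => div_ne_zero (hnz k).2.2 (hnz k).2.1,
    Finset.prod_div_distrib] at hlog
  change F (y + n) * _ = F y * ∏ k ∈ Finset.range n, q (y + k) at hprod1
  change F (y + t + n) * _ = F (y + t) * ∏ k ∈ Finset.range n, q (y + t + k) at hprod2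
  rw [show y + n = x by rw [hy]; ring] at hprod1
  rw [show y + t + n = x + r + n by rw [hy, hrdef]; ring, show y + t = x + r by
    rw [hy, hrdef]; ring] at hprod2
  rw [show y + t = x + r by rw [hy, hrdef]; ring] at hQ' hlog
  set Q := ∏ k ∈ Finset.range n, q (y + k)
  set Q' := ∏ k ∈ Finset.range n, q (x + r + k)
  set P := ∏ k ∈ Finset.range n, p (y + k)
  have hmain : F x * F (x + r) * Q' = F (x + r + n) * F y * Q := by
    apply mul_right_cancel₀ hP
    linear_combination (F (x + r) * Q') * hprod1 - (F y * Q) * hprod2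
  have hQle : Q ≤ Real.exp l * Q' := by
    have h1 : Real.exp (-l) < Q' / Q := by
      rw [← Real.lt_log_iff_exp_lt (div_pos hQ' hQ)]
      exact (abs_lt.1 hlog).1
    rw [lt_div_iff₀ hQ, Real.exp_neg, inv_mul_lt_iff₀ (Real.exp_pos l)] at h1
    exact h1.le
  have h1 : δ * δ * Q' < F x * F (x + r) * Q' := by gcongr
  have h2 : F (x + r + n) * F y * Q ≤ ε * ε * (Real.exp l * Q') := by
    gcongr
    exact hF0 _
  have h3 : ε * ε * (Real.exp l * Q') = δ * δ * Q' * Real.exp (-l) := by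
    rw [hε, Real.exp_neg]; field_simp
  have h4 : δ * δ * Q' * Real.exp (-l) ≤ δ * δ * Q' * 1 := by
    gcongr
    exact Real.exp_le_one_iff.2 (by linarith)
  linarith

/-- A property of real numbers invariant under integer translations holds almost everywhere if it
does so on the unit interval. -/
theorem ae_of_ae_restrict_Icc {p : ℝ → Prop} (hp : ∀ (x : ℝ) (m : ℤ), p (x + m) → p x)
    (h : ∀ᵐ x ∂(volume.restrict (Set.Icc (0 : ℝ) 1)), p x) : ∀ᵐ x, p x := by
  rw [ae_restrict_iff' measurableSet_Icc] at h
  have hm : ∀ m : ℤ, ∀ᵐ x : ℝ, x + m ∈ Set.Icc (0 : ℝ) 1 → p (x + m) := fun m =>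
    (measurePreserving_add_right volume (m : ℝ)).quasiMeasurePreserving.ae h
  filter_upwards [ae_all_iff.2 hm] with x hx
  refine hp x (-⌊x⌋) (hx _ ?_)
  push_cast
  constructor <;> linarith [Int.floor_le x, Int.lt_floor_add_one x]

theorem norm_add_mul_e_eq_norm_conj (C D : ℂ) (x : ℝ) :
    ‖C + D * e x‖ = ‖(starRingEnd ℂ) D + (starRingEnd ℂ) C * e x‖ := by
  have he : e x ≠ 0 := norm_ne_zero_iff.1 (by rw [norm_e]; exact one_ne_zero)
  rw [← RCLike.norm_conj (C + D * e x), ← mul_one ‖(starRingEnd ℂ) (C + D * e x)‖, ← norm_e x,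
    ← norm_mul]
  congr 1
  rw [map_add, map_mul, conj_e]
  field_simp
  ring

/-- The special (2,2) recurrence `f(x+1)(A + Be(αx)) = f(x)(C + De(βx))` with `α/β`
irrational admits no nontrivial continuous solution with minimal decay along integer
translates for a.e. `x ∈ [0,1]`. -/
theorem no_continuous_solution_special_two_two
    (A B C D : ℂ) (hA : A ≠ 0) (hB : B ≠ 0) (hC : C ≠ 0) (hD : D ≠ 0)
    (α β : ℝ) (hα : α ≠ 0) (hβ : β ≠ 0) (hirr : Irrational (α / β))
    (f : ℝ → ℂ) (hf : Continuous f)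
    (heq : ∀ᵐ x : ℝ, f (x + 1) * (A + B * e (α * x)) = f x * (C + D * e (β * x)))
    (hdecay : ∀ᵐ x ∂(volume.restrict (Set.Icc (0 : ℝ) 1)),
      Tendsto (fun n : ℤ => f (x + n)) atTop (nhds 0) ∧
      Tendsto (fun n : ℤ => f (x + n)) atBot (nhds 0)) :
    ∀ x : ℝ, f x = 0 := by
  have hall : ∀ x, f (x + 1) * (A + B * e (α * x)) = f x * (C + D * e (β * x)) := by
    refine congrFun ((Continuous.ae_eq_iff_eq volume ?_ ?_).1 heq)
    all_goals have := continuous_e; fun_prop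
  have hdecay' := ae_of_ae_restrict_Icc (fun x m h => by
    have hshift : ∀ n : ℤ, f (x + n) = f (x + m + (n + -m : ℤ)) := by
      intro n; push_cast; ring_nf
    simp only [hshift]
    exact ⟨h.1.comp (tendsto_atTop_add_const_right _ (-m) tendsto_id),
      h.2.comp (tendsto_atBot_add_const_right _ (-m) tendsto_id)⟩) hdecay
  have hτ : 0 < 1 / |α| := one_div_pos.2 (abs_pos.2 hα)
  have hirr' : Irrational (β * (1 / |α|)) := by
    have h1 : Irrational (β / α) := by simpa using hirr.inv
    rcases abs_choice α with h | h <;> rw [h]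
    · simpa [div_eq_mul_inv] using h1
    · simpa [div_eq_mul_inv] using h1
  have hper : Function.Periodic (fun x => ‖A + B * e (α * x)‖) (1 / |α|) := by
    intro x
    obtain ⟨i, hi⟩ : ∃ i : ℤ, α * (1 / |α|) = i := by
      rcases abs_choice α with h | h <;> rw [h]
      · exact ⟨1, by simp [hα]⟩
      · exact ⟨-1, by field_simp; simp⟩
    simp only [mul_add, hi, e_add, e_intCast, mul_one]
  have hp0 : {x | ‖A + B * e (α * x)‖ = 0}.Countable := by
    simpa using countable_setOf_add_mul_e_eq_zero (b := B) hA hα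
  have hnorm : ∀ x, ‖f (x + 1)‖ * ‖A + B * e (α * x)‖ = ‖f x‖ * ‖C + D * e (β * x)‖ := by
    intro x
    rw [← norm_mul, hall, norm_mul]
  have hpos : ∀ᵐ x : ℝ, Tendsto (fun n : ℕ => ‖f (x + n)‖) atTop (nhds 0) := by
    filter_upwards [hdecay'] with x hx
    simpa using (hx.1.comp tendsto_natCast_atTop_atTop).norm
  have hneg : ∀ᵐ x : ℝ, Tendsto (fun n : ℕ => ‖f (x + -n)‖) atTop (nhds 0) := by
    filter_upwards [hdecay'] with x hx
    simpa using (hx.2.comp (tendsto_neg_atTop_atBot.comp tendsto_natCast_atTop_atTop)).norm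
  intro x
  rw [← norm_eq_zero]
  rcases le_total ‖D‖ ‖C‖ with h | h
  · exact eq_zero_of_recurrence_of_norm_le (F := fun x => ‖f x‖) hC h hτ hβ hirr' hf.norm
      (fun _ => norm_nonneg _) hper hp0 hnorm hpos hneg x
  · refine eq_zero_of_recurrence_of_norm_le (F := fun x => ‖f x‖)
      (C := (starRingEnd ℂ) D) (D := (starRingEnd ℂ) C) (by simpa using hD) (by simpa using h)
      hτ hβ hirr' hf.norm (fun _ => norm_nonneg _) hper hp0 (fun x => ?_) hpos hneg x
    rw [← norm_add_mul_e_eq_norm_conj]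
    exact hnorm x
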